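/- Let V ⊆ ℂ be a nonempty connected open set, ρ a holomorphic function on V, and let (w₁, w₂) and (ŵ₁, ŵ₂) be pairs of holomorphic functions on V, each solving Hill's equation w'' + (ρ/4) w = 0 and each with Wronskian identically 1/2. Then |ŵ₁|² + |ŵ₂|² = |w₁|² + |w₂|² on V if and only if there exists a matrix U ∈ SU(2) with (ŵ₁, ŵ₂)ᵀ = U (w₁, w₂)ᵀ on V. (Hence for each ρ the space of solutions u = log(|w₁|² + |w₂|²) is identified with SL(2,ℂ)/SU(2).) -/

import Mathlib

open scoped ComplexConjugate

/-- The Wronskian of two solutions of Hill's equation on a connected open set is constant. -/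
lemma exists_wronskian_eq_const {V : Set ℂ} (hV : IsOpen V) (hVconn : IsPreconnected V)
    {ρ f g : ℂ → ℂ} (hf : DifferentiableOn ℂ f V) (hg : DifferentiableOn ℂ g V)
    (hHf : ∀ z ∈ V, deriv (deriv f) z + ρ z / 4 * f z = 0)
    (hHg : ∀ z ∈ V, deriv (deriv g) z + ρ z / 4 * g z = 0) :
    ∃ c, ∀ z ∈ V, f z * deriv g z - g z * deriv f z = c := by
  have hD : ∀ z ∈ V, HasDerivAt (fun z => f z * deriv g z - g z * deriv f z) 0 z := by
    intro z hz
    have hn := hV.mem_nhds hz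
    have hf' := ((hf.deriv hV).differentiableAt hn).hasDerivAt
    have hg' := ((hg.deriv hV).differentiableAt hn).hasDerivAt
    have h := ((hf.differentiableAt hn).hasDerivAt.mul hg').sub
      ((hg.differentiableAt hn).hasDerivAt.mul hf')
    refine h.congr_deriv ?_
    linear_combination f z * hHg z hz - g z * hHf z hz
  exact hV.exists_is_const_of_deriv_eq_zero hVconn
    (fun z hz => (hD z hz).differentiableAt.differentiableWithinAt) (fun z hz => (hD z hz).deriv)

/-- A solution of Hill's equation is a linear combination of two solutions whose Wronskian
is `1/2`. -/
lemma exists_eq_linear_combination {V : Set ℂ} (hV : IsOpen V) (hVconn : IsPreconnected V)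
    {ρ w₁ w₂ v : ℂ → ℂ} (hw₁ : DifferentiableOn ℂ w₁ V) (hw₂ : DifferentiableOn ℂ w₂ V)
    (hv : DifferentiableOn ℂ v V)
    (hHw₁ : ∀ z ∈ V, deriv (deriv w₁) z + ρ z / 4 * w₁ z = 0)
    (hHw₂ : ∀ z ∈ V, deriv (deriv w₂) z + ρ z / 4 * w₂ z = 0)
    (hHv : ∀ z ∈ V, deriv (deriv v) z + ρ z / 4 * v z = 0)
    (hW : ∀ z ∈ V, w₁ z * deriv w₂ z - w₂ z * deriv w₁ z = 1 / 2) :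
    ∃ a b, ∀ z ∈ V, v z = a * w₁ z + b * w₂ z := by
  obtain ⟨a, ha⟩ := exists_wronskian_eq_const hV hVconn hv hw₂ hHv hHw₂
  obtain ⟨b, hb⟩ := exists_wronskian_eq_const hV hVconn hw₁ hv hHw₁ hHv
  refine ⟨2 * a, 2 * b, fun z hz => ?_⟩
  rw [← ha z hz, ← hb z hz]
  linear_combination -2 * v z * hW z hz

/-- On an open set, a linear combination of differentiable functions may be differentiated. -/
lemma deriv_eq_linear_combination {V : Set ℂ} (hV : IsOpen V) {w₁ w₂ v : ℂ → ℂ} {a b : ℂ}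
    (hw₁ : DifferentiableOn ℂ w₁ V) (hw₂ : DifferentiableOn ℂ w₂ V)
    (h : ∀ z ∈ V, v z = a * w₁ z + b * w₂ z) {z : ℂ} (hz : z ∈ V) :
    deriv v z = a * deriv w₁ z + b * deriv w₂ z := by
  have hn := hV.mem_nhds hz
  have hd := ((hw₁.differentiableAt hn).hasDerivAt.const_mul a).add
    ((hw₂.differentiableAt hn).hasDerivAt.const_mul b)
  refine (hd.congr_of_eventuallyEq ?_).deriv
  filter_upwards [hn] with x hx using h x hx

/-- A linear combination of two functions with Wronskian `1/2` vanishes only trivially. -/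
lemma eq_zero_of_linear_combination_eq_zero {V : Set ℂ} (hV : IsOpen V) (hne : V.Nonempty)
    {w₁ w₂ : ℂ → ℂ} {a b : ℂ}
    (hw₁ : DifferentiableOn ℂ w₁ V) (hw₂ : DifferentiableOn ℂ w₂ V)
    (hW : ∀ z ∈ V, w₁ z * deriv w₂ z - w₂ z * deriv w₁ z = 1 / 2)
    (h : ∀ z ∈ V, a * w₁ z + b * w₂ z = 0) : a = 0 ∧ b = 0 := by
  obtain ⟨z, hz⟩ := hne
  have h0 := h z hz
  have h1 := deriv_eq_linear_combination (v := fun _ => 0) hV hw₁ hw₂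
    (fun x hx => (h x hx).symm) hz
  rw [deriv_const] at h1
  constructor
  · linear_combination 2 * deriv w₂ z * h0 + 2 * w₂ z * h1 - 2 * a * hW z hz
  · linear_combination -2 * deriv w₁ z * h0 - 2 * w₁ z * h1 - 2 * b * hW z hz

/-- The derivative of `|f|²` along a real line. -/
lemma hasDerivAt_conj_mul_self_line {f : ℂ → ℂ} {z : ℂ} (hf : DifferentiableAt ℂ f z) (d : ℂ) :
    HasDerivAt (fun t : ℝ => conj (f (z + t * d)) * f (z + t * d))
      (conj (deriv f z * d) * f z + conj (f z) * (deriv f z * d)) 0 := by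
  have hl : HasDerivAt (fun t : ℝ => z + (t : ℂ) * d) d 0 := by
    simpa using ((Complex.ofRealCLM.hasDerivAt (x := 0)).mul_const d).const_add z
  have hf' : HasDerivAt f (deriv f z) (z + ((0 : ℝ) : ℂ) * d) := by
    simpa using hf.hasDerivAt
  have h := hf'.comp (0 : ℝ) hl
  refine (h.star.mul h).congr_deriv ?_
  simp

/-- If `|v₁|² + |v₂|² = |w₁|² + |w₂|²` on an open set, then the `∂/∂z` derivatives of both sides
agree. -/
lemma conj_mul_deriv_eq_of_norm_sq_eq {V : Set ℂ} (hV : IsOpen V) {w₁ w₂ v₁ v₂ : ℂ → ℂ}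
    (hw₁ : DifferentiableOn ℂ w₁ V) (hw₂ : DifferentiableOn ℂ w₂ V)
    (hv₁ : DifferentiableOn ℂ v₁ V) (hv₂ : DifferentiableOn ℂ v₂ V)
    (h : ∀ z ∈ V, conj (v₁ z) * v₁ z + conj (v₂ z) * v₂ z =
      conj (w₁ z) * w₁ z + conj (w₂ z) * w₂ z) {z : ℂ} (hz : z ∈ V) :
    conj (v₁ z) * deriv v₁ z + conj (v₂ z) * deriv v₂ z =
      conj (w₁ z) * deriv w₁ z + conj (w₂ z) * deriv w₂ z := by
  have hn := hV.mem_nhds hz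
  have key (d : ℂ) := by
    have hv := (hasDerivAt_conj_mul_self_line (hv₁.differentiableAt hn) d).add
      (hasDerivAt_conj_mul_self_line (hv₂.differentiableAt hn) d)
    have hw := (hasDerivAt_conj_mul_self_line (hw₁.differentiableAt hn) d).add
      (hasDerivAt_conj_mul_self_line (hw₂.differentiableAt hn) d)
    refine hv.unique (hw.congr_of_eventuallyEq ?_)
    have hc : ContinuousAt (fun t : ℝ => z + (t : ℂ) * d) 0 := by fun_prop
    filter_upwards [hc.preimage_mem_nhds (by simpa using hn)] with t ht using h _ ht
  have h1 := key 1
  have hI := key Complex.I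
  simp only [map_mul, map_one, Complex.conj_I] at h1 hI
  linear_combination (1 / 2 : ℂ) * h1 - Complex.I / 2 * hI + (1 / 2 : ℂ) *
    (conj (v₁ z) * deriv v₁ z + conj (v₂ z) * deriv v₂ z -
      conj (w₁ z) * deriv w₁ z - conj (w₂ z) * deriv w₂ z - conj (deriv v₁ z) * v₁ z
      - conj (deriv v₂ z) * v₂ z + conj (deriv w₁ z) * w₁ z + conj (deriv w₂ z) * w₂ z) *
      Complex.I_sq


/-- Two pairs of holomorphic solutions of Hill's equation `w'' + (ρ/4) w = 0`
on a nonempty connected open set `V`, each with Wronskian identically `1/2`,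
give rise to the same function `|w₁|² + |w₂|²` if and only if they differ by
the action of a matrix `U ∈ SU(2)`. -/
theorem hill_solutions_same_norm_iff_su2
    (V : Set ℂ) (hV : IsOpen V) (hVconn : IsConnected V)
    (ρ : ℂ → ℂ) (hρ : DifferentiableOn ℂ ρ V)
    (w₁ w₂ v₁ v₂ : ℂ → ℂ)
    (hw₁ : DifferentiableOn ℂ w₁ V) (hw₂ : DifferentiableOn ℂ w₂ V)
    (hv₁ : DifferentiableOn ℂ v₁ V) (hv₂ : DifferentiableOn ℂ v₂ V)
    (hHillw₁ : ∀ z ∈ V, deriv (deriv w₁) z + ρ z / 4 * w₁ z = 0)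
    (hHillw₂ : ∀ z ∈ V, deriv (deriv w₂) z + ρ z / 4 * w₂ z = 0)
    (hHillv₁ : ∀ z ∈ V, deriv (deriv v₁) z + ρ z / 4 * v₁ z = 0)
    (hHillv₂ : ∀ z ∈ V, deriv (deriv v₂) z + ρ z / 4 * v₂ z = 0)
    (hWw : ∀ z ∈ V, w₁ z * deriv w₂ z - w₂ z * deriv w₁ z = 1 / 2)
    (hWv : ∀ z ∈ V, v₁ z * deriv v₂ z - v₂ z * deriv v₁ z = 1 / 2) :
    (∀ z ∈ V, ‖v₁ z‖ ^ 2 + ‖v₂ z‖ ^ 2 = ‖w₁ z‖ ^ 2 + ‖w₂ z‖ ^ 2) ↔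
    (∃ U ∈ Matrix.specialUnitaryGroup (Fin 2) ℂ,
      ∀ z ∈ V,
        v₁ z = U 0 0 * w₁ z + U 0 1 * w₂ z ∧
        v₂ z = U 1 0 * w₁ z + U 1 1 * w₂ z) := by
  have hnorm (x y : ℂ) : ((‖x‖ ^ 2 + ‖y‖ ^ 2 : ℝ) : ℂ) = conj x * x + conj y * y := by
    push_cast
    rw [Complex.conj_mul', Complex.conj_mul']
  have hiff (z : ℂ) : ‖v₁ z‖ ^ 2 + ‖v₂ z‖ ^ 2 = ‖w₁ z‖ ^ 2 + ‖w₂ z‖ ^ 2 ↔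
      conj (v₁ z) * v₁ z + conj (v₂ z) * v₂ z = conj (w₁ z) * w₁ z + conj (w₂ z) * w₂ z := by
    rw [← hnorm, ← hnorm, Complex.ofReal_inj]
  simp only [hiff]
  have hmem (U : Matrix (Fin 2) (Fin 2) ℂ) : U ∈ Matrix.specialUnitaryGroup (Fin 2) ℂ ↔
      (((conj (U 0 0) * U 0 0 + conj (U 1 0) * U 1 0 = 1 ∧
        conj (U 0 0) * U 0 1 + conj (U 1 0) * U 1 1 = 0) ∧
        conj (U 0 1) * U 0 0 + conj (U 1 1) * U 1 0 = 0 ∧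
        conj (U 0 1) * U 0 1 + conj (U 1 1) * U 1 1 = 1) ∧
        U 0 0 * U 1 1 - U 0 1 * U 1 0 = 1) := by
    rw [Matrix.mem_specialUnitaryGroup_iff, Matrix.mem_unitaryGroup_iff', ← Matrix.ext_iff]
    simp [Matrix.mul_apply, Fin.forall_fin_two, Fin.sum_univ_two, Matrix.det_fin_two]
  constructor
  · intro h
    have hconn := hVconn.isPreconnected
    obtain ⟨a, b, hab⟩ := exists_eq_linear_combination hV hconn hw₁ hw₂ hv₁
      hHillw₁ hHillw₂ hHillv₁ hWw
    obtain ⟨c, d, hcd⟩ := exists_eq_linear_combination hV hconn hw₁ hw₂ hv₂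
      hHillw₁ hHillw₂ hHillv₂ hWw
    have hdet : a * d - b * c = 1 := by
      obtain ⟨z, hz⟩ := hVconn.nonempty
      have h1 := hWv z hz
      rw [hab z hz, hcd z hz, deriv_eq_linear_combination hV hw₁ hw₂ hab hz,
        deriv_eq_linear_combination hV hw₁ hw₂ hcd hz] at h1
      linear_combination 2 * h1 - 2 * (a * d - b * c) * hWw z hz
    have hrows (z : ℂ) (hz : z ∈ V) :
        (conj (a * w₁ z + b * w₂ z) * a + conj (c * w₁ z + d * w₂ z) * c = conj (w₁ z)) ∧
        (conj (a * w₁ z + b * w₂ z) * b + conj (c * w₁ z + d * w₂ z) * d = conj (w₂ z)) := by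
      have h0 := h z hz
      have h1 := conj_mul_deriv_eq_of_norm_sq_eq hV hw₁ hw₂ hv₁ hv₂ h hz
      rw [deriv_eq_linear_combination hV hw₁ hw₂ hab hz,
        deriv_eq_linear_combination hV hw₁ hw₂ hcd hz] at h1
      rw [← hab z hz, ← hcd z hz]
      set p := conj (v₁ z)
      set q := conj (v₂ z)
      rw [hab z hz, hcd z hz] at h0
      constructor
      · linear_combination 2 * deriv w₂ z * h0 - 2 * w₂ z * h1 -
          2 * (p * a + q * c - conj (w₁ z)) * hWw z hz
      · linear_combination -2 * deriv w₁ z * h0 + 2 * w₁ z * h1 -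
          2 * (p * b + q * d - conj (w₂ z)) * hWw z hz
    have hcol₁ := eq_zero_of_linear_combination_eq_zero (a := conj a * a + conj c * c - 1)
      (b := conj a * b + conj c * d) hV hVconn.nonempty hw₁ hw₂ hWw (fun z hz => by
        have := congrArg conj (hrows z hz).1
        simp only [map_add, map_mul, Complex.conj_conj] at this
        linear_combination this)
    have hcol₂ := eq_zero_of_linear_combination_eq_zero (a := conj b * a + conj d * c)
      (b := conj b * b + conj d * d - 1) hV hVconn.nonempty hw₁ hw₂ hWw (fun z hz => by
        have := congrArg conj (hrows z hz).2
        simp only [map_add, map_mul, Complex.conj_conj] at this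
        linear_combination this)
    refine ⟨!![a, b; c, d], (hmem _).2 ?_, fun z hz => ⟨hab z hz, hcd z hz⟩⟩
    exact ⟨⟨⟨sub_eq_zero.1 hcol₁.1, hcol₁.2⟩, hcol₂.1, sub_eq_zero.1 hcol₂.2⟩, hdet⟩
  · rintro ⟨U, hU, h⟩ z hz
    obtain ⟨⟨⟨h00, h01⟩, h10, h11⟩, -⟩ := (hmem U).1 hU
    rw [(h z hz).1, (h z hz).2]
    simp only [map_add, map_mul]
    linear_combination conj (w₁ z) * w₁ z * h00 + conj (w₁ z) * w₂ z * h01 +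
      conj (w₂ z) * w₁ z * h10 + conj (w₂ z) * w₂ z * h11
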